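/- arXiv:math/0405370 — 3 statements merged into one kernel-verified Lean document; each statement's English description precedes it below -/
import Mathlib

section
/- Let n ≥ 1, ε ∈ (0,1], and let φ : ℝⁿ → ℂ be a Schwartz function. For t ∈ (0, π/2) ∪ (π/2, π) define V^ε(t)φ(x) := (cos t)^{−n/2} φ(x/cos t) e^{−i|x|² tan t/(2ε)} when 0 < t < π/2, and V^ε(t)φ(x) := e^{−inπ/2} |cos t|^{−n/2} φ(x/cos t) e^{−i|x|² tan t/(2ε)} when π/2 < t < π. Then for every θ ∈ (0, 1/2] and every t ∈ (0,π/2) ∪ (π/2,π): ‖ U^ε(t)φ − V^ε(t)φ ‖_{L²(ℝⁿ)} ≤ 2 |ε tan t|^θ ‖φ‖_{H¹}, where ‖φ‖_{H¹} denotes the H¹(ℝⁿ) norm and U^ε(t) is the harmonic-oscillator propagator given by Mehler's formula. -/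
open MeasureTheory Real Filter Topology
open scoped ENNReal NNReal ComplexConjugate

noncomputable section

/-- Euclidean space ℝⁿ. -/
abbrev Rn (n : ℕ) := EuclideanSpace ℝ (Fin n)

/-- The gradient of a complex-valued function on ℝⁿ, as a ℂⁿ-valued function. -/
def grad {n : ℕ} (φ : Rn n → ℂ) (x : Rn n) : Fin n → ℂ :=
  fun j => fderiv ℝ φ x (EuclideanSpace.single j 1)

/-- The gradient, valued in the Euclidean space ℂⁿ (so that its pointwise norm is the
Euclidean norm). -/
def gradE {n : ℕ} (φ : Rn n → ℂ) (x : Rn n) : EuclideanSpace ℂ (Fin n) :=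
  (WithLp.equiv 2 (Fin n → ℂ)).symm (grad φ x)

/-- The Laplacian of a complex-valued function on ℝⁿ. -/
def lap {n : ℕ} (φ : Rn n → ℂ) (x : Rn n) : ℂ :=
  ∑ j, fderiv ℝ (fun y => fderiv ℝ φ y (EuclideanSpace.single j 1)) x (EuclideanSpace.single j 1)

/-- The operator J^ε(t) = (x/ε) sin t − i cos t ∇ₓ. -/
def Jop {n : ℕ} (ε t : ℝ) (φ : Rn n → ℂ) (x : Rn n) : Fin n → ℂ :=
  fun j => ((x j / ε : ℝ) : ℂ) * ((Real.sin t : ℝ) : ℂ) * φ x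
    - Complex.I * ((Real.cos t : ℝ) : ℂ) * grad φ x j

/-- The operator H^ε(t) = x cos t + iε sin t ∇ₓ. -/
def Hop {n : ℕ} (ε t : ℝ) (φ : Rn n → ℂ) (x : Rn n) : Fin n → ℂ :=
  fun j => ((x j : ℝ) : ℂ) * ((Real.cos t : ℝ) : ℂ) * φ x
    + Complex.I * (ε : ℂ) * ((Real.sin t : ℝ) : ℂ) * grad φ x j

/-- J^ε(t)φ viewed as valued in Euclidean ℂⁿ. -/
def JopE {n : ℕ} (ε t : ℝ) (φ : Rn n → ℂ) (x : Rn n) : EuclideanSpace ℂ (Fin n) :=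
  (WithLp.equiv 2 (Fin n → ℂ)).symm (Jop ε t φ x)

/-- H^ε(t)φ viewed as valued in Euclidean ℂⁿ. -/
def HopE {n : ℕ} (ε t : ℝ) (φ : Rn n → ℂ) (x : Rn n) : EuclideanSpace ℂ (Fin n) :=
  (WithLp.equiv 2 (Fin n → ℂ)).symm (Hop ε t φ x)

/-- Convolution (|x|^{−γ} ∗ ψ)(x) of a real-valued ψ with the kernel |x|^{−γ}. -/
def conv {n : ℕ} (γ : ℝ) (ψ : Rn n → ℝ) (x : Rn n) : ℝ :=
  ∫ y : Rn n, ‖x - y‖ ^ (-γ) * ψ y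

/-- Convolution (|x|^{−γ} ∗ ψ)(x) of a complex-valued ψ with the kernel |x|^{−γ}. -/
def convC {n : ℕ} (γ : ℝ) (ψ : Rn n → ℂ) (x : Rn n) : ℂ :=
  ∫ y : Rn n, ((‖x - y‖ ^ (-γ) : ℝ) : ℂ) * ψ y

/-- The Hartree potential |x|^{−γ} ∗ |u|². -/
def hartree {n : ℕ} (γ : ℝ) (u : Rn n → ℂ) (x : Rn n) : ℝ :=
  conv γ (fun y => Complex.normSq (u y)) x

/-- `u` is a (smooth, Schwartz-in-x) solution of the semiclassical Hartree equation with
harmonic potential: iε∂ₜu + (ε²/2)Δu = (|x|²/2)u + ε^α(|x|^{−γ}∗|u|²)u, u(0) = f. -/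
structure IsSolutionH (n : ℕ) (α γ ε : ℝ) (f : Rn n → ℂ) (u : ℝ → Rn n → ℂ) : Prop where
  smooth : ContDiff ℝ (⊤ : ℕ∞) (fun p : ℝ × Rn n => u p.1 p.2)
  schwartz : ∀ t, ∃ φ : SchwartzMap (Rn n) ℂ, u t = ⇑φ
  init : u 0 = f
  eq : ∀ t x, Complex.I * (ε : ℂ) * deriv (fun s => u s x) t
      + ((ε ^ 2 / 2 : ℝ) : ℂ) * lap (u t) x
    = ((‖x‖ ^ 2 / 2 : ℝ) : ℂ) * u t x
      + ((ε ^ α : ℝ) : ℂ) * ((hartree γ (u t) x : ℝ) : ℂ) * u t x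

/-- `u` is a (smooth, Schwartz-in-x) solution of the linear equation
iε∂ₜu + (ε²/2)Δu = (|x|²/2)u. -/
structure IsLinSol (n : ℕ) (ε : ℝ) (u : ℝ → Rn n → ℂ) : Prop where
  smooth : ContDiff ℝ (⊤ : ℕ∞) (fun p : ℝ × Rn n => u p.1 p.2)
  schwartz : ∀ t, ∃ φ : SchwartzMap (Rn n) ℂ, u t = ⇑φ
  eq : ∀ t x, Complex.I * (ε : ℂ) * deriv (fun s => u s x) t
      + ((ε ^ 2 / 2 : ℝ) : ℂ) * lap (u t) x
    = ((‖x‖ ^ 2 / 2 : ℝ) : ℂ) * u t x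

/-- The semiclassical harmonic-oscillator propagator U^ε(t), via Mehler's formula
(for 0 < t < π). -/
def Uprop (n : ℕ) (ε t : ℝ) (φ : Rn n → ℂ) (x : Rn n) : ℂ :=
  Complex.exp (-Complex.I * (n : ℂ) * (π : ℂ) / 4) *
    ((2 * π * ε * Real.sin t : ℝ) : ℂ) ^ (-(n : ℂ) / 2) *
    ∫ y : Rn n, Complex.exp ((Complex.I / ((ε * Real.sin t : ℝ) : ℂ)) *
      (((‖x‖ ^ 2 + ‖y‖ ^ 2) / 2 * Real.cos t - ∑ j, x j * y j : ℝ) : ℂ)) * φ y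

/-- The WKB approximation operator V^ε(t) (for t ∈ (0,π/2) ∪ (π/2,π)). -/
def Vprop (n : ℕ) (ε t : ℝ) (φ : Rn n → ℂ) (x : Rn n) : ℂ :=
  if t < π / 2 then
    ((Real.cos t ^ (-(n : ℝ) / 2) : ℝ) : ℂ) * φ ((Real.cos t)⁻¹ • x) *
      Complex.exp (-Complex.I * ((‖x‖ ^ 2 * Real.tan t / (2 * ε) : ℝ) : ℂ))
  else
    Complex.exp (-Complex.I * (n : ℂ) * ((π / 2 : ℝ) : ℂ)) *
      ((|Real.cos t| ^ (-(n : ℝ) / 2) : ℝ) : ℂ) * φ ((Real.cos t)⁻¹ • x) *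
      Complex.exp (-Complex.I * ((‖x‖ ^ 2 * Real.tan t / (2 * ε) : ℝ) : ℂ))

/-- The Σ-norm ‖φ‖_Σ = ‖φ‖_{L²} + ‖|x|φ‖_{L²} + ‖∇φ‖_{L²}, with values in ℝ≥0∞. -/
def SigmaNorm {n : ℕ} (φ : Rn n → ℂ) : ℝ≥0∞ :=
  eLpNorm φ 2 volume + eLpNorm (fun x => (‖x‖ : ℂ) * φ x) 2 volume
    + eLpNorm (gradE φ) 2 volume

/-- The H¹-norm (‖φ‖_{L²}² + ‖∇φ‖_{L²}²)^{1/2}, with values in ℝ≥0∞. -/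
def H1norm {n : ℕ} (φ : Rn n → ℂ) : ℝ≥0∞ :=
  (eLpNorm φ 2 volume ^ (2 : ℝ) + eLpNorm (gradE φ) 2 volume ^ (2 : ℝ)) ^ ((1 : ℝ) / 2)

/-- The nonlinear WKB phase g(t,x) = −(|x|^{−γ}∗|f|²)(x) ∫₀ᵗ |cos τ|^{−γ} dτ. -/
def gphase {n : ℕ} (γ : ℝ) (f : Rn n → ℂ) (t : ℝ) (x : Rn n) : ℝ :=
  -(conv γ (fun y => Complex.normSq (f y)) x) * ∫ τ in (0 : ℝ)..t, |Real.cos τ| ^ (-γ)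

/-- The Fourier transform Fφ(ξ) = (2π)^{−n/2} ∫ e^{−ix·ξ} φ(x) dx. -/
def FT {n : ℕ} (φ : Rn n → ℂ) (ξ : Rn n) : ℂ :=
  (((2 * π : ℝ) ^ (-(n : ℝ) / 2) : ℝ) : ℂ) *
    ∫ x : Rn n, Complex.exp (-Complex.I * ((∑ j, x j * ξ j : ℝ) : ℂ)) * φ x

/-- The inverse Fourier transform. -/
def FTinv {n : ℕ} (φ : Rn n → ℂ) (ξ : Rn n) : ℂ :=
  (((2 * π : ℝ) ^ (-(n : ℝ) / 2) : ℝ) : ℂ) *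
    ∫ x : Rn n, Complex.exp (Complex.I * ((∑ j, x j * ξ j : ℝ) : ℂ)) * φ x


section
open SchwartzMap FourierTransform

theorem tg_exp : Function.HasTemperateGrowth (fun x : ℝ => Complex.exp (Complex.I * x)) := by
  refine ⟨(contDiff_const.mul Complex.ofRealCLM.contDiff).cexp, fun k => ⟨0, 1, fun x => ?_⟩⟩
  rw [norm_iteratedFDeriv_eq_norm_iteratedDeriv]
  have h : ∀ k : ℕ, iteratedDeriv k (fun x : ℝ => Complex.exp (Complex.I * x))
      = fun x : ℝ => Complex.I ^ k * Complex.exp (Complex.I * x) := by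
    intro k
    induction k with
    | zero => simp
    | succ k ih =>
      rw [iteratedDeriv_succ, ih]
      funext x
      have h1 : HasDerivAt (fun x : ℝ => Complex.I * (x : ℂ)) (Complex.I * 1) x :=
        (Complex.ofRealCLM.hasDerivAt).const_mul _
      have := (h1.cexp.const_mul (Complex.I ^ k)).deriv
      rw [this]; ring
  rw [h k]
  simp [mul_comm Complex.I, Complex.norm_exp_ofReal_mul_I]

theorem tg_mult (n : ℕ) (a : ℝ) : Function.HasTemperateGrowth
    (fun w : Rn n => Complex.exp (Complex.I * ((a * ‖w‖ ^ 2 : ℝ) : ℂ)) - 1) := by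
  have h2 : Function.HasTemperateGrowth (fun w : Rn n => a * ‖w‖ ^ 2) := 
    (Function.HasTemperateGrowth.const a).mul (Function.hasTemperateGrowth_norm_sq _)
  exact (tg_exp.comp h2).sub (Function.HasTemperateGrowth.const 1)

theorem plancherel {n : ℕ} (f : 𝓢(Rn n, ℂ)) : eLpNorm (𝓕 f : 𝓢(Rn n, ℂ)) 2 volume = eLpNorm f 2 volume := by
  have h := SchwartzMap.norm_fourier_toL2_eq f
  rw [SchwartzMap.norm_toLp, SchwartzMap.norm_toLp] at h
  exact (ENNReal.toReal_eq_toReal_iff' (SchwartzMap.memLp _ 2 volume).2.ne (SchwartzMap.memLp _ 2 volume).2.ne).1 h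

theorem eL2 {n : ℕ} {F : Type*} [NormedAddCommGroup F] (f : Rn n → F) :
    eLpNorm f 2 volume = (∫⁻ x, ‖f x‖ₑ ^ 2) ^ ((1:ℝ)/2) := by
  rw [eLpNorm_eq_lintegral_rpow_enorm_toReal (by norm_num) (by norm_num)]
  simp

theorem eL2sq {n : ℕ} {F : Type*} [NormedAddCommGroup F] (f : Rn n → F) :
    eLpNorm f 2 volume ^ (2:ℝ) = ∫⁻ x, ‖f x‖ₑ ^ 2 := by
  rw [eL2, ← ENNReal.rpow_mul]; norm_num

theorem four_deriv {n : ℕ} (φ : 𝓢(Rn n, ℂ)) (j : Fin n) :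
    ∫⁻ x, ‖fderiv ℝ φ x (EuclideanSpace.single j 1)‖ₑ ^ 2
      = ∫⁻ w, ENNReal.ofReal (4 * π ^ 2 * (w j) ^ 2) * ‖(𝓕 φ : 𝓢(Rn n, ℂ)) w‖ₑ ^ 2 := by
  have h := plancherel (LineDeriv.lineDerivOp (EuclideanSpace.single j (1:ℝ)) φ)
  have h' := congrArg (· ^ (2:ℝ)) h
  simp only [eL2sq] at h'
  rw [SchwartzMap.fourier_lineDerivOp_eq] at h'
  have e : ∀ x, (LineDeriv.lineDerivOp (EuclideanSpace.single j (1:ℝ)) φ : 𝓢(Rn n, ℂ)) x = fderiv ℝ φ x (EuclideanSpace.single j 1) := fun x => rfl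
  simp only [e] at h'
  rw [← h']
  refine lintegral_congr fun w => ?_
  have : (inner ℝ · (EuclideanSpace.single j (1:ℝ)) : Rn n → ℝ).HasTemperateGrowth := by fun_prop
  rw [smul_apply, SchwartzMap.smulLeftCLM_apply_apply this]
  simp only [EuclideanSpace.inner_single_right]
  rw [enorm_smul, enorm_smul, mul_pow, mul_pow, ← mul_assoc]
  congr 1
  rw [← ofReal_norm, ← ofReal_norm, ← ENNReal.ofReal_pow (by positivity), ← ENNReal.ofReal_pow (by positivity), ← ENNReal.ofReal_mul (by positivity)]
  congr 1
  simp [mul_pow, abs_of_pos Real.pi_pos]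
  left
  ring

theorem H1sq {n : ℕ} (φ : 𝓢(Rn n, ℂ)) :
    H1norm φ = (∫⁻ w, ENNReal.ofReal (1 + 4 * π ^ 2 * ‖w‖ ^ 2) * ‖(𝓕 φ : 𝓢(Rn n, ℂ)) w‖ₑ ^ 2) ^ ((1:ℝ)/2) := by
  unfold H1norm
  congr 1
  have hg : ∀ x, ‖gradE φ x‖ₑ ^ 2 = ∑ j, ‖fderiv ℝ φ x (EuclideanSpace.single j 1)‖ₑ ^ 2 := by
    intro x
    simp only [← ofReal_norm]
    simp_rw [← ENNReal.ofReal_pow (norm_nonneg _)]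
    rw [EuclideanSpace.norm_sq_eq, ENNReal.ofReal_sum_of_nonneg (by intros; positivity)]
    rfl
  rw [← plancherel φ, eL2sq, eL2sq]
  simp_rw [hg]
  have hm : ∀ j : Fin n, Measurable fun x => ‖fderiv ℝ φ x (EuclideanSpace.single j 1)‖ₑ ^ 2 := by
    intro j
    have : Continuous fun x => (LineDeriv.lineDerivOp (EuclideanSpace.single j (1:ℝ)) φ : 𝓢(Rn n, ℂ)) x := SchwartzMap.continuous _
    exact (this.enorm.measurable).pow_const 2
  have hF : Measurable fun w => ‖(𝓕 φ : 𝓢(Rn n, ℂ)) w‖ₑ ^ 2 := ((SchwartzMap.continuous _).enorm.measurable).pow_const 2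
  rw [lintegral_finsetSum _ (fun j _ => hm j)]
  simp_rw [four_deriv]
  rw [← lintegral_finsetSum _ (fun j _ => by fun_prop), ← lintegral_add_left hF]
  refine lintegral_congr fun w => ?_
  rw [← Finset.sum_mul, ← ENNReal.ofReal_sum_of_nonneg (by intros; positivity), ENNReal.ofReal_add (by positivity) (by positivity), add_mul, ENNReal.ofReal_one, one_mul, ← Finset.mul_sum, EuclideanSpace.norm_sq_eq]
  simp

theorem mult_bd {n : ℕ} (τ θ : ℝ) (hθ : θ ∈ Set.Ioc (0 : ℝ) (1 / 2)) (w : Rn n) :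
    ‖Complex.exp (Complex.I * ((-(2 * π ^ 2 * τ) * ‖w‖ ^ 2 : ℝ) : ℂ)) - 1‖ ^ 2 ≤
      (2 * |τ| ^ θ) ^ 2 * (1 + 4 * π ^ 2 * ‖w‖ ^ 2) := by
  set N := ‖Complex.exp (Complex.I * ((-(2 * π ^ 2 * τ) * ‖w‖ ^ 2 : ℝ) : ℂ)) - 1‖ with hN
  obtain ⟨h0, h1⟩ := hθ
  set A := |τ| * (π ^ 2 * ‖w‖ ^ 2) with hA
  have hA0 : 0 ≤ A := by positivity
  have b1 : N ≤ 2 * A := by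
    refine (Real.norm_exp_I_mul_ofReal_sub_one_le).trans (le_of_eq ?_)
    rw [Real.norm_eq_abs, abs_mul, abs_neg, abs_mul, abs_of_nonneg (by positivity : 0 ≤ 2 * π ^ 2), abs_of_nonneg (by positivity : 0 ≤ ‖w‖ ^ 2), hA]; ring
  have b2 : N ≤ 2 := by
    refine (norm_sub_le _ _).trans ?_
    rw [mul_comm, Complex.norm_exp_ofReal_mul_I]; norm_num
  have b3 : N ≤ 2 * A ^ θ := by
    rcases le_total A 1 with h | h
    · have : A ≤ A ^ θ := by
        simpa using Real.rpow_le_rpow_of_exponent_ge' hA0 h h0.le (by linarith : θ ≤ 1)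
      linarith
    · have := Real.one_le_rpow h h0.le
      linarith
  have b4 : (A ^ θ) ≤ |τ| ^ θ * (1 + 4 * π ^ 2 * ‖w‖ ^ 2) ^ ((1:ℝ)/2) := by
    rw [hA, Real.mul_rpow (by positivity) (by positivity)]
    gcongr ?_ * ?_
    have hh : 0 ≤ π ^ 2 * ‖w‖ ^ 2 := by positivity
    calc _ ≤ (1 + 4 * π ^ 2 * ‖w‖ ^ 2) ^ θ := by
          apply Real.rpow_le_rpow hh _ h0.le; nlinarith
      _ ≤ _ := Real.rpow_le_rpow_of_exponent_le (by nlinarith) h1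
  have b5 : N ≤ (2 * |τ| ^ θ) * (1 + 4 * π ^ 2 * ‖w‖ ^ 2) ^ ((1:ℝ)/2) := by nlinarith
  calc N ^ 2 ≤ ((2 * |τ| ^ θ) * (1 + 4 * π ^ 2 * ‖w‖ ^ 2) ^ ((1:ℝ)/2)) ^ 2 := by
        gcongr
    _ = _ := by
      rw [mul_pow, ← Real.sqrt_eq_rpow, Real.sq_sqrt (by positivity)]

/-- The difference of the free propagator and the identity, as a Schwartz function. -/
def diffS {n : ℕ} (τ : ℝ) (φ : 𝓢(Rn n, ℂ)) : 𝓢(Rn n, ℂ) :=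
  𝓕⁻ (SchwartzMap.smulLeftCLM ℂ (fun w : Rn n => Complex.exp (Complex.I * ((-(2 * π ^ 2 * τ) * ‖w‖ ^ 2 : ℝ) : ℂ)) - 1) (𝓕 φ))

theorem diffS_bd {n : ℕ} (τ θ : ℝ) (hθ : θ ∈ Set.Ioc (0 : ℝ) (1 / 2)) (φ : 𝓢(Rn n, ℂ)) :
    eLpNorm (diffS τ φ) 2 volume ≤ ENNReal.ofReal (2 * |τ| ^ θ) * H1norm φ := by
  rw [← plancherel]
  unfold diffS
  rw [FourierTransform.fourier_fourierInv_eq, eL2, H1sq]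
  have : ENNReal.ofReal (2 * |τ| ^ θ) = (ENNReal.ofReal ((2 * |τ| ^ θ) ^ 2)) ^ ((1:ℝ)/2) := by
    rw [ENNReal.ofReal_pow (by positivity), ← ENNReal.rpow_natCast, ← ENNReal.rpow_mul]
    norm_num
  rw [this, ← ENNReal.mul_rpow_of_nonneg _ _ (by norm_num)]
  gcongr
  rw [← lintegral_const_mul' _ _ (by simp)]
  refine lintegral_mono fun w => ?_
  rw [SchwartzMap.smulLeftCLM_apply_apply (tg_mult n _), enorm_smul, mul_pow, ← mul_assoc]
  gcongr
  rw [← ofReal_norm, ← ENNReal.ofReal_pow (by positivity), ← ENNReal.ofReal_mul (by positivity)]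
  exact ENNReal.ofReal_le_ofReal (mult_bd τ θ hθ w)
theorem kernel_reg {n : ℕ} (b : ℂ) (hb : 0 < b.re) (φ : 𝓢(Rn n, ℂ)) (z : Rn n) :
    (π / b) ^ ((n:ℂ) / 2) * ∫ y, Complex.exp (-π ^ 2 * ‖z - y‖ ^ 2 / b) * φ y
      = ∫ w, Complex.exp (-b * ‖w‖ ^ 2 + 2 * π * Complex.I * (inner ℝ z w : ℝ)) * (𝓕 φ : 𝓢(Rn n, ℂ)) w := by
  have hG := GaussianFourier.integrable_cexp_neg_mul_sq_norm_add (V := Rn n) hb (2 * π * Complex.I) z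
  have key := VectorFourier.integral_fourierIntegral_smul_eq_flip (L := innerₗ (Rn n)) (μ := volume) (ν := volume)
    Real.continuous_fourierChar continuous_inner hG φ.integrable
  rw [flip_innerₗ] at key
  simp only [smul_eq_mul] at key
  rw [← integral_const_mul]
  have e1 : ∀ y, VectorFourier.fourierIntegral Real.fourierChar volume (innerₗ (Rn n))
     (fun v : Rn n ↦ Complex.exp (-b * ‖v‖ ^ 2 + 2 * π * Complex.I * (inner ℝ z v : ℝ))) y = (π / b) ^ ((n:ℂ) / 2) * Complex.exp (-π ^ 2 * ‖z - y‖ ^ 2 / b) := by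
    intro y
    have := fourier_gaussian_innerProductSpace' hb z y
    rw [finrank_euclideanSpace, Fintype.card_fin] at this
    exact this
  simp only [e1] at key
  simp only [← mul_assoc]
  exact key

theorem kernel_lim {n : ℕ} (τ : ℝ) (hτ : τ ≠ 0) (φ : 𝓢(Rn n, ℂ)) (z : Rn n) :
    (π / (2 * π ^ 2 * Complex.I * τ)) ^ ((n:ℂ) / 2) * ∫ y, Complex.exp (-π ^ 2 * ‖z - y‖ ^ 2 / (2 * π ^ 2 * Complex.I * τ)) * φ y
      = ∫ w, Complex.exp (-(2 * π ^ 2 * Complex.I * τ) * ‖w‖ ^ 2 + 2 * π * Complex.I * (inner ℝ z w : ℝ)) * (𝓕 φ : 𝓢(Rn n, ℂ)) w := by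
  set b0 : ℂ := 2 * π ^ 2 * Complex.I * τ with hb0
  have hπ := Real.pi_pos
  have hre : b0.re = 0 := by simp [hb0, ← Complex.ofReal_pow]
  have him : b0.im = 2 * π ^ 2 * τ := by simp [hb0, ← Complex.ofReal_pow]
  have hb00 : b0 ≠ 0 := by
    intro h; rw [h] at him; simp at him; exact hτ him
  have hB : Tendsto (fun δ : ℝ => b0 + δ) (𝓝[>] 0) (𝓝 b0) := by
    have : Continuous fun δ : ℝ => b0 + (δ : ℂ) := by fun_prop
    have := this.tendsto 0
    simp only [Complex.ofReal_zero, add_zero] at this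
    exact this.mono_left nhdsWithin_le_nhds
  have hpos : ∀ δ : ℝ, 0 < δ → 0 < (b0 + δ).re := by intro δ h; simp [hre, h]
  have hev : ∀ᶠ δ : ℝ in 𝓝[>] 0, 0 < δ := self_mem_nhdsWithin
  have hslit : (π / b0 : ℂ) ∈ Complex.slitPlane := by
    right
    rw [div_eq_mul_inv, Complex.im_ofReal_mul, Complex.inv_im, him]
    have : Complex.normSq b0 ≠ 0 := by simpa using hb00
    exact mul_ne_zero hπ.ne' (div_ne_zero (neg_ne_zero.2 (by positivity)) this)
  have hL : Tendsto (fun δ : ℝ => (π / (b0 + δ) : ℂ) ^ ((n:ℂ) / 2) * ∫ y, Complex.exp (-π ^ 2 * ‖z - y‖ ^ 2 / (b0 + δ)) * φ y) (𝓝[>] 0)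
      (𝓝 ((π / b0 : ℂ) ^ ((n:ℂ) / 2) * ∫ y, Complex.exp (-π ^ 2 * ‖z - y‖ ^ 2 / b0) * φ y)) := by
    refine Tendsto.mul ((tendsto_const_nhds.div hB hb00).cpow tendsto_const_nhds hslit) ?_
    refine tendsto_integral_filter_of_dominated_convergence (fun y => ‖φ y‖) ?_ ?_ φ.integrable.norm ?_
    · refine Eventually.of_forall fun δ => Continuous.aestronglyMeasurable ?_
      have := φ.continuous
      fun_prop
    · filter_upwards [hev] with δ hδ
      refine Eventually.of_forall fun y => ?_
      rw [norm_mul]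
      refine mul_le_of_le_one_left (norm_nonneg _) ?_
      rw [Complex.norm_exp, Real.exp_le_one_iff]
      have e : (-π ^ 2 * ‖z - y‖ ^ 2 / (b0 + δ) : ℂ) = ((-(π ^ 2 * ‖z - y‖ ^ 2) : ℝ) : ℂ) * (b0 + δ)⁻¹ := by
        push_cast; ring
      rw [e, Complex.re_ofReal_mul, Complex.inv_re]
      have h1 := hpos δ hδ
      have h2 := Complex.normSq_nonneg (b0 + δ)
      have : 0 ≤ π ^ 2 * ‖z - y‖ ^ 2 * ((b0 + δ).re / Complex.normSq (b0 + δ)) := by positivity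
      linarith
    · refine Eventually.of_forall fun y => ?_
      exact (((tendsto_const_nhds.div hB hb00)).cexp).mul_const _
  have hR : Tendsto (fun δ : ℝ => ∫ w, Complex.exp (-(b0 + δ) * ‖w‖ ^ 2 + 2 * π * Complex.I * (inner ℝ z w : ℝ)) * (𝓕 φ : 𝓢(Rn n, ℂ)) w) (𝓝[>] 0)
      (𝓝 (∫ w, Complex.exp (-b0 * ‖w‖ ^ 2 + 2 * π * Complex.I * (inner ℝ z w : ℝ)) * (𝓕 φ : 𝓢(Rn n, ℂ)) w)) := by
    refine tendsto_integral_filter_of_dominated_convergence (fun w => ‖(𝓕 φ : 𝓢(Rn n, ℂ)) w‖) ?_ ?_ (SchwartzMap.integrable _).norm ?_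
    · refine Eventually.of_forall fun δ => Continuous.aestronglyMeasurable ?_
      have := (𝓕 φ : 𝓢(Rn n, ℂ)).continuous
      fun_prop
    · filter_upwards [hev] with δ hδ
      refine Eventually.of_forall fun y => ?_
      rw [norm_mul]
      refine mul_le_of_le_one_left (norm_nonneg _) ?_
      rw [Complex.norm_exp, Real.exp_le_one_iff]
      have e : (-(b0 + δ) * ‖y‖ ^ 2 + 2 * π * Complex.I * (inner ℝ z y : ℝ) : ℂ) = ((‖y‖ ^ 2 : ℝ) : ℂ) * (-(b0 + δ)) + ((2 * π * inner ℝ z y : ℝ) : ℂ) * Complex.I := by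
        push_cast; ring
      rw [e, Complex.add_re, Complex.re_ofReal_mul, Complex.re_ofReal_mul, Complex.I_re, Complex.neg_re]
      have h1 := hpos δ hδ
      have : 0 ≤ ‖y‖ ^ 2 * (b0 + δ).re := by positivity
      linarith
    · refine Eventually.of_forall fun y => ?_
      exact (((hB.neg.mul_const _).add_const _).cexp).mul_const _
  refine tendsto_nhds_unique_of_eventuallyEq hL hR ?_
  filter_upwards [hev] with δ hδ
  exact kernel_reg _ (hpos δ hδ) φ z

theorem diffS_eq {n : ℕ} (τ : ℝ) (hτ : τ ≠ 0) (φ : 𝓢(Rn n, ℂ)) (z : Rn n) :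
    (π / (2 * π ^ 2 * Complex.I * τ)) ^ ((n:ℂ) / 2) * (∫ y, Complex.exp (-π ^ 2 * ‖z - y‖ ^ 2 / (2 * π ^ 2 * Complex.I * τ)) * φ y)
      - φ z = diffS τ φ z := by
  rw [kernel_lim τ hτ]
  have h1 : φ z = ∫ w, Complex.exp (2 * π * Complex.I * (inner ℝ z w : ℝ)) * (𝓕 φ : 𝓢(Rn n, ℂ)) w := by
    conv_lhs => rw [← FourierTransform.fourierInv_fourier_eq (F := 𝓢(Rn n, ℂ)) φ, SchwartzMap.fourierInv_coe, Real.fourierInv_eq']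
    refine integral_congr_ae (Eventually.of_forall fun w => ?_)
    simp only [smul_eq_mul]
    congr 2
    rw [real_inner_comm]; push_cast; ring
  have hi : ∀ a : ℝ, Integrable fun w : Rn n => Complex.exp (((a * ‖w‖ ^ 2 + 2 * π * (inner ℝ z w : ℝ) : ℝ) : ℂ) * Complex.I) * (𝓕 φ : 𝓢(Rn n, ℂ)) w := by
    intro a
    refine (SchwartzMap.integrable (𝓕 φ : 𝓢(Rn n, ℂ))).norm.mono' (Continuous.aestronglyMeasurable ?_) (Eventually.of_forall fun w => ?_)
    · have := (𝓕 φ : 𝓢(Rn n, ℂ)).continuous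
      fun_prop
    · rw [norm_mul, Complex.norm_exp_ofReal_mul_I, one_mul]
  rw [h1, ← integral_sub]
  · unfold diffS
    rw [SchwartzMap.fourierInv_coe, Real.fourierInv_eq']
    refine integral_congr_ae (Eventually.of_forall fun w => ?_)
    simp only
    rw [SchwartzMap.smulLeftCLM_apply_apply (tg_mult n _), smul_eq_mul, smul_eq_mul, ← mul_assoc, mul_sub, ← Complex.exp_add, mul_one, sub_mul]
    congr 2
    · congr 1
      rw [real_inner_comm]; push_cast; ring
    · congr 1
      rw [real_inner_comm]; push_cast; ring
  · refine (hi (-(2 * π ^ 2 * τ))).congr (Eventually.of_forall fun w => ?_)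
    simp only
    congr 2
    push_cast; ring
  · refine (hi 0).congr (Eventually.of_forall fun w => ?_)
    simp only
    congr 2
    push_cast; ring

/-- Scaling invariance. -/
theorem scale_L2 {n : ℕ} (c : ℝ) (hc : c ≠ 0) (f : Rn n → ℂ) (hf : Continuous f) (g : Rn n → ℂ)
    (hg : ∀ x, ‖g x‖ = |c| ^ (-(n:ℝ)/2) * ‖f (c⁻¹ • x)‖) :
    eLpNorm g 2 volume = eLpNorm f 2 volume := by
  have h1 : ∀ x, ‖g x‖ₑ ^ 2 = ENNReal.ofReal (|c ^ n|⁻¹) * ‖f (c⁻¹ • x)‖ₑ ^ 2 := by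
    intro x
    rw [← ofReal_norm, ← ofReal_norm, hg, ENNReal.ofReal_mul (by positivity), mul_pow, ← ENNReal.ofReal_pow (by positivity)]
    congr 2
    rw [← Real.rpow_natCast, ← Real.rpow_mul (abs_nonneg c), abs_pow, ← Real.rpow_natCast, ← Real.rpow_neg (abs_nonneg c)]
    congr 1; push_cast; ring
  rw [eL2, eL2]
  congr 1
  simp_rw [h1]
  have hm : Measurable fun x => ‖f x‖ₑ ^ 2 := (hf.enorm.measurable).pow_const 2
  have hsm : Measurable fun x : Rn n => c⁻¹ • x := by fun_prop
  rw [lintegral_const_mul' _ _ (by simp), ← lintegral_map (f := fun x => ‖f x‖ₑ ^ 2) hm hsm,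
    Measure.map_addHaar_smul volume (inv_ne_zero hc), lintegral_smul_measure, smul_eq_mul, ← mul_assoc, ← ENNReal.ofReal_mul (by positivity)]
  rw [finrank_euclideanSpace, Fintype.card_fin]
  have : |c ^ n|⁻¹ * |(c⁻¹ ^ n)⁻¹| = 1 := by
    rw [inv_pow, inv_inv]
    exact inv_mul_cancel₀ (by positivity)
  rw [this]; simp

theorem pref_pos (n : ℕ) (ε s c : ℝ) (hε : 0 < ε) (hs : 0 < s) (hc : 0 < c) :
    Complex.exp (-Complex.I * (n : ℂ) * (π : ℂ) / 4) * ((2 * π * ε * s : ℝ) : ℂ) ^ (-(n : ℂ) / 2)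
      = ((c ^ (-(n : ℝ) / 2) : ℝ) : ℂ) * (π / (2 * π ^ 2 * Complex.I * ((ε * (s / c) : ℝ) : ℂ))) ^ ((n:ℂ) / 2) := by
  have hπ := Real.pi_pos
  have hr : 0 < c / (2 * π * ε * s) := by positivity
  have e : (π / (2 * π ^ 2 * Complex.I * ((ε * (s / c) : ℝ) : ℂ)) : ℂ) = ((c / (2 * π * ε * s) : ℝ) : ℂ) * (-Complex.I) := by
    have h1 : (π : ℂ) ≠ 0 := by exact_mod_cast hπ.ne'
    have h2 : (ε : ℂ) ≠ 0 := by exact_mod_cast hε.ne'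
    have h3 : (s : ℂ) ≠ 0 := by exact_mod_cast hs.ne'
    have h4 : (c : ℂ) ≠ 0 := by exact_mod_cast hc.ne'
    push_cast
    rw [← Complex.inv_I]
    field_simp [Complex.I_ne_zero]
  have hp : 0 < 2 * π * ε * s := by positivity
  rw [e, Complex.cpow_def_of_ne_zero (by exact_mod_cast hp.ne'), Complex.cpow_def_of_ne_zero
    (mul_ne_zero (by exact_mod_cast hr.ne') (by simp)), Complex.log_ofReal_mul hr (by simp), Complex.log_neg_I,
    Real.rpow_def_of_pos hc, Real.log_div hc.ne' hp.ne', ← Complex.ofReal_log hp.le, Complex.ofReal_exp, ← Complex.exp_add, ← Complex.exp_add]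
  congr 1
  push_cast
  ring

theorem pref_neg (n : ℕ) (ε s c : ℝ) (hε : 0 < ε) (hs : 0 < s) (hc : c < 0) :
    Complex.exp (-Complex.I * (n : ℂ) * (π : ℂ) / 4) * ((2 * π * ε * s : ℝ) : ℂ) ^ (-(n : ℂ) / 2)
      = Complex.exp (-Complex.I * (n : ℂ) * ((π / 2 : ℝ) : ℂ)) * ((|c| ^ (-(n : ℝ) / 2) : ℝ) : ℂ) * (π / (2 * π ^ 2 * Complex.I * ((ε * (s / c) : ℝ) : ℂ))) ^ ((n:ℂ) / 2) := by
  have hπ := Real.pi_pos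
  rw [abs_of_neg hc]
  have hc' : 0 < -c := by linarith
  have hr : 0 < -c / (2 * π * ε * s) := by positivity
  have e : (π / (2 * π ^ 2 * Complex.I * ((ε * (s / c) : ℝ) : ℂ)) : ℂ) = ((-c / (2 * π * ε * s) : ℝ) : ℂ) * Complex.I := by
    have h1 : (π : ℂ) ≠ 0 := by exact_mod_cast hπ.ne'
    have h2 : (ε : ℂ) ≠ 0 := by exact_mod_cast hε.ne'
    have h3 : (s : ℂ) ≠ 0 := by exact_mod_cast hs.ne'
    have h4 : (c : ℂ) ≠ 0 := by exact_mod_cast hc.ne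
    push_cast
    field_simp [Complex.I_ne_zero]
    simp
  have hp : 0 < 2 * π * ε * s := by positivity
  rw [e, Complex.cpow_def_of_ne_zero (by exact_mod_cast hp.ne'), Complex.cpow_def_of_ne_zero
    (mul_ne_zero (by exact_mod_cast hr.ne') (by simp)), Complex.log_ofReal_mul hr (by simp), Complex.log_I,
    Real.rpow_def_of_pos hc', Real.log_div hc'.ne' hp.ne', ← Complex.ofReal_log hp.le, Complex.ofReal_exp, ← Complex.exp_add, ← Complex.exp_add, ← Complex.exp_add]
  congr 1
  push_cast
  ring

theorem phase_int (n : ℕ) (ε s c : ℝ) (hε : 0 < ε) (hs : 0 < s) (hc : c ≠ 0) (hsc : s ^ 2 + c ^ 2 = 1)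
    (φ : Rn n → ℂ) (x : Rn n) :
    (∫ y : Rn n, Complex.exp ((Complex.I / ((ε * s : ℝ) : ℂ)) *
      (((‖x‖ ^ 2 + ‖y‖ ^ 2) / 2 * c - ∑ j, x j * y j : ℝ) : ℂ)) * φ y)
    = Complex.exp (-Complex.I * ((‖x‖ ^ 2 * (s / c) / (2 * ε) : ℝ) : ℂ)) *
      ∫ y, Complex.exp (-π ^ 2 * ‖c⁻¹ • x - y‖ ^ 2 / (2 * π ^ 2 * Complex.I * ((ε * (s / c) : ℝ) : ℂ))) * φ y := by
  rw [← integral_const_mul]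
  refine integral_congr_ae (Eventually.of_forall fun y => ?_)
  simp only
  rw [← mul_assoc, ← Complex.exp_add]
  congr 2
  have hin : ∑ j, x j * y j = inner ℝ x y := by
    simp [PiLp.inner_apply, mul_comm]
  rw [hin]
  have hn : ‖c⁻¹ • x - y‖ ^ 2 = c⁻¹ ^ 2 * ‖x‖ ^ 2 - 2 * (c⁻¹ * inner ℝ x y) + ‖y‖ ^ 2 := by
    rw [norm_sub_sq_real, norm_smul, real_inner_smul_left, mul_pow, Real.norm_eq_abs, sq_abs]
  rw [← Complex.ofReal_pow ‖c⁻¹ • x - y‖, hn]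
  generalize inner ℝ x y = p
  generalize ‖x‖ = X
  generalize ‖y‖ = Y
  have h1 : (π : ℂ) ≠ 0 := by exact_mod_cast Real.pi_pos.ne'
  have h2 : (ε : ℂ) ≠ 0 := by exact_mod_cast hε.ne'
  have h3 : (s : ℂ) ≠ 0 := by exact_mod_cast hs.ne'
  have h4 : (c : ℂ) ≠ 0 := by exact_mod_cast hc
  have h5 : (s : ℂ) ^ 2 = 1 - (c : ℂ) ^ 2 := by
    have h : s ^ 2 = 1 - c ^ 2 := by linarith
    exact_mod_cast congrArg (fun r : ℝ => (r : ℂ)) h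
  have h6 : (-π ^ 2 * ((c⁻¹ ^ 2 * X ^ 2 - 2 * (c⁻¹ * p) + Y ^ 2 : ℝ) : ℂ) / (2 * π ^ 2 * Complex.I * ((ε * (s / c) : ℝ) : ℂ)) : ℂ)
      = Complex.I * (c⁻¹ ^ 2 * X ^ 2 - 2 * (c⁻¹ * p) + Y ^ 2) * c / (2 * ε * s) := by
    push_cast
    rw [div_eq_iff (by simp [h1, h2, h3, h4, Complex.I_ne_zero])]
    have : Complex.I ^ 2 = -1 := Complex.I_sq
    field_simp
    rw [this]
    ring
  rw [h6]
  push_cast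
  field_simp
  rw [h5]
  ring

theorem main_aux (n : ℕ) (ε t θ : ℝ) (hε : 0 < ε) (φ : 𝓢(Rn n, ℂ)) (hθ : θ ∈ Set.Ioc (0 : ℝ) (1 / 2))
    (hs : 0 < Real.sin t) (hc : Real.cos t ≠ 0) (P : ℂ) (hP : ‖P‖ = |Real.cos t| ^ (-(n : ℝ) / 2))
    (hpre : Complex.exp (-Complex.I * (n : ℂ) * (π : ℂ) / 4) * ((2 * π * ε * Real.sin t : ℝ) : ℂ) ^ (-(n : ℂ) / 2)
      = P * (π / (2 * π ^ 2 * Complex.I * ((ε * (Real.sin t / Real.cos t) : ℝ) : ℂ))) ^ ((n:ℂ) / 2))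
    (hV : ∀ x, Vprop n ε t φ x = P * φ ((Real.cos t)⁻¹ • x) * Complex.exp (-Complex.I * ((‖x‖ ^ 2 * Real.tan t / (2 * ε) : ℝ) : ℂ))) :
    eLpNorm (fun x => Uprop n ε t ⇑φ x - Vprop n ε t ⇑φ x) 2 volume
      ≤ ENNReal.ofReal (2 * |ε * Real.tan t| ^ θ) * H1norm (⇑φ) := by
  have hτ : ε * Real.tan t ≠ 0 := by
    rw [Real.tan_eq_sin_div_cos]
    exact mul_ne_zero hε.ne' (div_ne_zero hs.ne' hc)
  refine le_of_eq_of_le ?_ (diffS_bd (ε * Real.tan t) θ hθ φ)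
  refine scale_L2 (Real.cos t) hc _ (SchwartzMap.continuous _) _ fun x => ?_
  have h := diffS_eq (ε * Real.tan t) hτ φ ((Real.cos t)⁻¹ • x)
  have key : Uprop n ε t φ x - Vprop n ε t φ x = Complex.exp (-Complex.I * ((‖x‖ ^ 2 * Real.tan t / (2 * ε) : ℝ) : ℂ)) * P * diffS (ε * Real.tan t) φ ((Real.cos t)⁻¹ • x) := by
    rw [← h, hV]
    unfold Uprop
    rw [phase_int n ε _ _ hε hs hc (Real.sin_sq_add_cos_sq t), hpre, Real.tan_eq_sin_div_cos]
    ring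
  rw [key, norm_mul, norm_mul, hP]
  have : ‖Complex.exp (-Complex.I * ((‖x‖ ^ 2 * Real.tan t / (2 * ε) : ℝ) : ℂ))‖ = 1 := by
    rw [neg_mul, mul_comm, ← neg_mul, ← Complex.ofReal_neg, Complex.norm_exp_ofReal_mul_I]
  rw [this, one_mul]
end

/-- comparison of the harmonic propagator U^ε(t) (Mehler's formula) with
the WKB operator V^ε(t): for t ∈ (0,π/2) ∪ (π/2,π) and θ ∈ (0,1/2],
‖U^ε(t)φ − V^ε(t)φ‖_{L²} ≤ 2|ε tan t|^θ ‖φ‖_{H¹}. -/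
theorem stmt12 (n : ℕ) (hn : 1 ≤ n) (ε : ℝ) (hε : ε ∈ Set.Ioc (0 : ℝ) 1)
    (φ : SchwartzMap (Rn n) ℂ) (θ : ℝ) (hθ : θ ∈ Set.Ioc (0 : ℝ) (1 / 2))
    (t : ℝ) (ht : t ∈ Set.Ioo 0 (π / 2) ∪ Set.Ioo (π / 2) π) :
    eLpNorm (fun x => Uprop n ε t ⇑φ x - Vprop n ε t ⇑φ x) 2 volume
      ≤ ENNReal.ofReal (2 * |ε * Real.tan t| ^ θ) * H1norm (⇑φ) := by
  have hπ := Real.pi_pos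
  rcases ht with ⟨h0, h1⟩ | ⟨h0, h1⟩
  · have hs := Real.sin_pos_of_pos_of_lt_pi h0 (by linarith)
    have hc : 0 < Real.cos t := Real.cos_pos_of_mem_Ioo ⟨by linarith, h1⟩
    refine main_aux n ε t θ hε.1 φ hθ hs hc.ne' _ ?_ (pref_pos n ε _ _ hε.1 hs hc) ?_
    · rw [abs_of_pos hc, Complex.norm_real, Real.norm_of_nonneg (by positivity)]
    · intro x
      simp only [Vprop, if_pos h1]
  · have hs := Real.sin_pos_of_pos_of_lt_pi (by linarith) h1
    have hc : Real.cos t < 0 := Real.cos_neg_of_pi_div_two_lt_of_lt h0 (by linarith)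
    refine main_aux n ε t θ hε.1 φ hθ hs hc.ne _ ?_ (pref_neg n ε _ _ hε.1 hs hc) ?_
    · rw [norm_mul, Complex.norm_real, Real.norm_of_nonneg (by positivity)]
      have : -Complex.I * (n : ℂ) * ((π / 2 : ℝ) : ℂ) = ((-(n * (π / 2)) : ℝ) : ℂ) * Complex.I := by
        push_cast; ring
      rw [this, Complex.norm_exp_ofReal_mul_I, one_mul]
    · intro x
      simp only [Vprop, if_neg (not_lt.2 h0.le)]

end
end

section
/- Let n ≥ 2 and 1 < γ < min(4, n). Then there exist q, r, s, k ∈ [1, ∞] satisfying simultaneously: (a) 1/r′ = 1/r + 2/s + γ/n − 1 and s < 2n/(n−γ); (b) 1/q′ = 1/q + 2/k; (c) (q,r) is an admissible pair, i.e. 2 ≤ r < 2n/(n−2) (2 ≤ r < ∞ if n = 2) and 2/q = δ(r); (d) 0 < 1/k < δ(s) < 1; where δ(r) := n(1/2 − 1/r) and r′, q′ denote Hölder conjugates. -/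
open MeasureTheory Real Filter Topology
open scoped ENNReal NNReal ComplexConjugate

noncomputable section

/-- the algebraic lemma: for n ≥ 2 and 1 < γ < min(4,n) there exist
exponents q, r, s, k satisfying (a) 1/r′ = 1/r + 2/s + γ/n − 1 and s < 2n/(n−γ);
(b) 1/q′ = 1/q + 2/k; (c) (q,r) admissible; (d) 0 < 1/k < δ(s) < 1. (Here 1/r′ = 1 − 1/r
and 1/q′ = 1 − 1/q are the conjugate exponents, δ(r) = n(1/2 − 1/r).) -/
theorem stmt15 (n : ℕ) (hn : 2 ≤ n) (γ : ℝ) (hγ1 : 1 < γ) (hγ2 : γ < min 4 (n : ℝ)) :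
    ∃ q r s k : ℝ, 1 ≤ q ∧ 1 ≤ r ∧ 1 ≤ s ∧ 1 ≤ k
      ∧ (1 - 1 / r = 1 / r + 2 / s + γ / n - 1 ∧ s < 2 * n / ((n : ℝ) - γ))
      ∧ (1 - 1 / q = 1 / q + 2 / k)
      ∧ (2 ≤ r ∧ (2 < n → r < 2 * n / ((n : ℝ) - 2))
          ∧ 2 / q = (n : ℝ) * (1 / 2 - 1 / r))
      ∧ (0 < 1 / k ∧ 1 / k < (n : ℝ) * (1 / 2 - 1 / s)
          ∧ (n : ℝ) * (1 / 2 - 1 / s) < 1) := by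
  have hγ4 : γ < 4 := lt_of_lt_of_le hγ2 (min_le_left _ _)
  have hγn : γ < (n : ℝ) := lt_of_lt_of_le hγ2 (min_le_right _ _)
  have hn2 : (2 : ℝ) ≤ n := by exact_mod_cast hn
  obtain ⟨d, hd1, hd2⟩ : ∃ d, max 0 (γ / 2 - 1) < d ∧ d < min 1 (γ - 1) := by
    apply exists_between
    rw [max_lt_iff, lt_min_iff, lt_min_iff]
    refine ⟨⟨?_, ?_⟩, ?_, ?_⟩ <;> linarith
  rw [max_lt_iff] at hd1
  rw [lt_min_iff] at hd2
  obtain ⟨hd0, hdγ⟩ := hd1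
  obtain ⟨hd1, hdγ1⟩ := hd2
  have hn0 : (0 : ℝ) < n := by linarith
  have hnd : 0 < (n : ℝ) - 2 * d := by linarith
  have hns : 0 < (n : ℝ) - γ + 2 * d := by linarith
  have hnγ : 0 < (n : ℝ) - γ := by linarith
  have h1d : 0 < 1 - d := by linarith
  have hs : (n : ℝ) * (1 / 2 - 1 / (2 * n / ((n : ℝ) - γ + 2 * d))) = γ / 2 - d := by
    field_simp
    ring
  have hk : 1 / (2 / (1 - d)) = (1 - d) / 2 := by
    field_simp
  refine ⟨2 / d, 2 * n / (n - 2 * d), 2 * n / (n - γ + 2 * d), 2 / (1 - d),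
    ?_, ?_, ?_, ?_, ⟨?_, ?_⟩, ?_, ⟨?_, ?_, ?_⟩, ?_, ?_, ?_⟩
  · rw [le_div_iff₀ hd0]; linarith
  · rw [le_div_iff₀ hnd]; linarith
  · rw [le_div_iff₀ hns]; linarith
  · rw [le_div_iff₀ h1d]; linarith
  · field_simp
    ring
  · apply div_lt_div_of_pos_left <;> linarith
  · field_simp
    ring
  · rw [le_div_iff₀ hnd]; linarith
  · intro h
    have h' : (2 : ℝ) < n := by exact_mod_cast h
    apply div_lt_div_of_pos_left <;> linarith
  · field_simp
    ring
  · rw [hk]; linarith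
  · rw [hk, hs]; linarith
  · rw [hs]; linarith
end
end

section
/- Let n ≥ 1, ε ∈ (0,1], and let φ : ℝⁿ → ℂ be a Schwartz function. Then for every t ∈ (0, π/2) the following three pointwise identities of ℂⁿ-valued functions of x hold: (i) J^ε(t)( U^ε(t)φ ) = U^ε(t)( −i∇φ ), (ii) H^ε(t)( U^ε(t)φ ) = U^ε(t)( x ↦ xφ(x) ), and (iii) J^ε(t)( V^ε(t)φ ) = V^ε(t)( −i∇φ ), where U^ε(t) is the harmonic-oscillator propagator given by Mehler's formula, V^ε(t)φ(x) := (cos t)^{−n/2} φ(x/cos t) e^{−i|x|² tan t/(2ε)}, and U^ε(t), V^ε(t) act componentwise on ℂⁿ-valued functions. -/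
open MeasureTheory Real Filter Topology
open scoped ENNReal NNReal ComplexConjugate

noncomputable section

/-- The oscillating Mehler kernel. -/
def mehlerK {n : ℕ} (a c : ℝ) (x y : Rn n) : ℂ :=
  Complex.exp ((Complex.I / (a : ℂ)) *
      (((‖x‖ ^ 2 + ‖y‖ ^ 2) / 2 * c - ∑ j, x j * y j : ℝ) : ℂ))

lemma sum_eq_inner {n : ℕ} (x y : Rn n) : ∑ j, x j * y j = inner ℝ y x := by
  simp [PiLp.inner_apply]

lemma mehlerK_norm {n : ℕ} (a c : ℝ) (x y : Rn n) : ‖mehlerK a c x y‖ = 1 := by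
  unfold mehlerK
  generalize ((‖x‖ ^ 2 + ‖y‖ ^ 2) / 2 * c - ∑ j, x j * y j : ℝ) = r
  rw [show (Complex.I / (a : ℂ)) * (r : ℂ) = ((r / a : ℝ) : ℂ) * Complex.I by
    push_cast; ring]
  exact Complex.norm_exp_ofReal_mul_I _

lemma mehlerK_symm {n : ℕ} (a c : ℝ) (x y : Rn n) : mehlerK a c x y = mehlerK a c y x := by
  unfold mehlerK
  rw [add_comm (‖x‖ ^ 2)]
  simp only [mul_comm]

lemma mehlerK_cont {n : ℕ} (a c : ℝ) (x : Rn n) : Continuous (fun y => mehlerK a c x y) := by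
  unfold mehlerK
  fun_prop

/-- The derivative of the phase in `x`. -/
def phaseD {n : ℕ} (c : ℝ) (x y : Rn n) : Rn n →L[ℝ] ℂ :=
  Complex.ofRealCLM.comp (c • innerSL ℝ x - innerSL ℝ y)

lemma phaseD_single {n : ℕ} (c : ℝ) (x y : Rn n) (j : Fin n) :
    phaseD c x y (EuclideanSpace.single j 1) = ((c * x j - y j : ℝ) : ℂ) := by
  simp [phaseD, EuclideanSpace.inner_single_right]

lemma phaseD_cont {n : ℕ} (c : ℝ) (x : Rn n) : Continuous (fun y => phaseD c x y) := by
  unfold phaseD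
  fun_prop

lemma phaseD_norm {n : ℕ} (c : ℝ) (x y : Rn n) : ‖phaseD c x y‖ ≤ |c| * ‖x‖ + ‖y‖ := by
  unfold phaseD
  refine (ContinuousLinearMap.opNorm_comp_le _ _).trans ?_
  rw [Complex.ofRealCLM_norm, one_mul]
  refine (norm_sub_le _ _).trans ?_
  rw [norm_smul, innerSL_apply_norm, innerSL_apply_norm, Real.norm_eq_abs]

lemma mehlerK_hasFDerivAt {n : ℕ} (a c : ℝ) (x y : Rn n) :
    HasFDerivAt (fun x => mehlerK a c x y)
      ((mehlerK a c x y * (Complex.I / (a : ℂ))) • phaseD c x y) x := by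
  have h1 : HasFDerivAt (fun x : Rn n => (‖x‖ ^ 2 + ‖y‖ ^ 2) / 2 * c - ∑ j, x j * y j)
      (c • innerSL ℝ x - innerSL ℝ y) x := by
    simp only [sum_eq_inner]
    have h2 := (hasStrictFDerivAt_norm_sq x).hasFDerivAt
    have h3 := (((h2.add_const (‖y‖ ^ 2)).const_mul (c / 2))).sub ((innerSL ℝ y).hasFDerivAt (x := x))
    refine (h3.congr_fderiv ?_).congr_of_eventuallyEq ?_
    · ext v
      simp
      ring
    · refine Eventually.of_forall fun z => ?_
      simp
      ring
  have h4 := (Complex.ofRealCLM.hasFDerivAt.comp x h1).const_mul (Complex.I / (a : ℂ))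
  have h5 := h4.cexp
  refine (h5.congr_fderiv ?_)
  ext v
  simp [mehlerK, phaseD]
  ring

lemma mehlerK_hasFDerivAt_right {n : ℕ} (a c : ℝ) (x y : Rn n) :
    HasFDerivAt (fun y => mehlerK a c x y)
      ((mehlerK a c x y * (Complex.I / (a : ℂ))) • phaseD c y x) y := by
  have := mehlerK_hasFDerivAt a c y x
  simp only [mehlerK_symm a c _ x] at this
  exact this

lemma mehler_integrable {n : ℕ} (a c : ℝ) (x : Rn n) {f : Rn n → ℂ} (hf : Integrable f) :
    Integrable (fun y => mehlerK a c x y * f y) := by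
  refine hf.bdd_mul (c := 1) (mehlerK_cont a c x).aestronglyMeasurable ?_
  exact Eventually.of_forall fun y => (mehlerK_norm a c x y).le

lemma coord_integrable {n : ℕ} (φ : SchwartzMap (Rn n) ℂ) (j : Fin n) :
    Integrable (fun y : Rn n => ((y j : ℝ) : ℂ) * φ y) := by
  refine (φ.integrable_pow_mul volume 1).mono ?_ ?_
  · have := φ.continuous
    exact Continuous.aestronglyMeasurable (by fun_prop)
  · refine Eventually.of_forall fun y => ?_
    simp only [norm_mul, Complex.norm_real, pow_one, norm_norm]
    gcongr
    exact PiLp.norm_apply_le y j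

lemma grad_integrable {n : ℕ} (φ : SchwartzMap (Rn n) ℂ) (v : Rn n) :
    Integrable (fun y : Rn n => fderiv ℝ φ y v) := by
  have := (SchwartzMap.fderivCLM ℝ (Rn n) ℂ φ).integrable (μ := volume)
  exact (ContinuousLinearMap.apply ℝ ℂ v).integrable_comp this

lemma mehler_hasFDerivAt {n : ℕ} (a c : ℝ) (φ : SchwartzMap (Rn n) ℂ) (x : Rn n) :
    ∃ L : Rn n →L[ℝ] ℂ, HasFDerivAt (fun x => ∫ y, mehlerK a c x y * φ y) L x ∧
      ∀ j, L (EuclideanSpace.single j 1) = (Complex.I / (a : ℂ)) *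
        (((c * x j : ℝ) : ℂ) * (∫ y, mehlerK a c x y * φ y)
          - ∫ y, mehlerK a c x y * (((y j : ℝ) : ℂ) * φ y)) := by
  let F' : Rn n → Rn n → (Rn n →L[ℝ] ℂ) := fun x y =>
    (φ y * (mehlerK a c x y * (Complex.I / (a : ℂ)))) • phaseD c x y
  have hφc := φ.continuous
  have hK := mehlerK_cont a c x
  have hP := phaseD_cont c x
  have hmeas : AEStronglyMeasurable (F' x) volume := by
    refine Continuous.aestronglyMeasurable ?_
    simp only [F']
    fun_prop
  let bound : Rn n → ℝ := fun y =>
    ‖Complex.I / (a : ℂ)‖ * (|c| * (‖x‖ + 1) * ‖φ y‖ + ‖y‖ ^ 1 * ‖φ y‖)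
  have hb : Integrable bound := by
    refine Integrable.const_mul ?_ _
    exact ((φ.integrable.norm).const_mul _).add (φ.integrable_pow_mul volume 1)
  have hbound : ∀ y, ∀ z ∈ Metric.ball x 1, ‖F' z y‖ ≤ bound y := by
    intro y z hz
    have hz' : ‖z‖ ≤ ‖x‖ + 1 := by
      have h1 : ‖z - x‖ < 1 := by simpa [dist_eq_norm] using hz
      have h2 := norm_add_le x (z - x)
      rw [add_sub_cancel] at h2
      linarith
    simp only [F', bound, norm_smul, norm_mul, mehlerK_norm, one_mul]
    calc _ ≤ ‖φ y‖ * ‖Complex.I / (a : ℂ)‖ * (|c| * (‖x‖ + 1) + ‖y‖) := by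
          gcongr
          refine (phaseD_norm c z y).trans ?_
          gcongr
      _ = _ := by ring
  have hF'int : Integrable (F' x) :=
    hb.mono' hmeas (Eventually.of_forall fun y => hbound y x (Metric.mem_ball_self one_pos))
  have key := hasFDerivAt_integral_of_dominated_of_fderiv_le (𝕜 := ℝ) (μ := (volume : Measure (Rn n)))
    (F := fun x y => mehlerK a c x y * φ y) (F' := F') (x₀ := x) (bound := bound)
    (Metric.ball_mem_nhds x one_pos)
    (Eventually.of_forall fun z => (mehler_integrable a c z φ.integrable).aestronglyMeasurable)
    (mehler_integrable a c x φ.integrable) hmeas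
    (Eventually.of_forall hbound) hb
    (Eventually.of_forall fun y z _ => by
      have := (mehlerK_hasFDerivAt a c z y).mul_const (φ y)
      refine this.congr_fderiv ?_
      simp only [F', smul_smul])
  refine ⟨_, key, fun j => ?_⟩
  rw [ContinuousLinearMap.integral_apply hF'int]
  have e : ∀ y, F' x y (EuclideanSpace.single j 1) = (Complex.I / (a : ℂ)) *
      (((c * x j : ℝ) : ℂ) * (mehlerK a c x y * φ y)
        - mehlerK a c x y * (((y j : ℝ) : ℂ) * φ y)) := by
    intro y
    simp only [F', ContinuousLinearMap.smul_apply, phaseD_single, smul_eq_mul]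
    push_cast
    ring
  simp only [e]
  rw [integral_const_mul, integral_sub ((mehler_integrable a c x φ.integrable).const_mul _)
    (mehler_integrable a c x (coord_integrable φ j)), integral_const_mul]

lemma mehler_parts {n : ℕ} (a c : ℝ) (φ : SchwartzMap (Rn n) ℂ) (x : Rn n) (j : Fin n) :
    ∫ y, mehlerK a c x y * fderiv ℝ φ y (EuclideanSpace.single j 1)
      = -((Complex.I / (a : ℂ)) * ((c : ℂ) * (∫ y, mehlerK a c x y * (((y j : ℝ) : ℂ) * φ y))
          - ((x j : ℝ) : ℂ) * ∫ y, mehlerK a c x y * φ y)) := by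
  have h1 := mehler_integrable a c x φ.integrable
  have h2 := mehler_integrable a c x (coord_integrable φ j)
  have e : ∀ y, fderiv ℝ (fun y => mehlerK a c x y) y (EuclideanSpace.single j 1) * φ y
      = (Complex.I / (a : ℂ)) * ((c : ℂ) * (mehlerK a c x y * (((y j : ℝ) : ℂ) * φ y))
          - ((x j : ℝ) : ℂ) * (mehlerK a c x y * φ y)) := by
    intro y
    rw [(mehlerK_hasFDerivAt_right a c x y).fderiv]
    simp only [ContinuousLinearMap.smul_apply, phaseD_single, smul_eq_mul]
    push_cast
    ring
  rw [integral_mul_fderiv_eq_neg_fderiv_mul_of_integrable (f := fun y => mehlerK a c x y)]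
  · simp only [e]
    rw [integral_const_mul, integral_sub (h2.const_mul _) (h1.const_mul _), integral_const_mul,
      integral_const_mul]
  · simp only [e]
    exact ((h2.const_mul _).sub (h1.const_mul _)).const_mul _
  · exact mehler_integrable a c x (grad_integrable φ _)
  · exact h1
  · exact fun y _ => (mehlerK_hasFDerivAt_right a c x y).differentiableAt
  · exact fun y _ => φ.differentiableAt

/-- The prefactor in Mehler's formula. -/
def mehlerC (n : ℕ) (ε t : ℝ) : ℂ :=
  Complex.exp (-Complex.I * (n : ℂ) * (π : ℂ) / 4) *
    ((2 * π * ε * Real.sin t : ℝ) : ℂ) ^ (-(n : ℂ) / 2)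

lemma Uprop_eq (n : ℕ) (ε t : ℝ) (f : Rn n → ℂ) (x : Rn n) :
    Uprop n ε t f x = mehlerC n ε t * ∫ y, mehlerK (ε * Real.sin t) (Real.cos t) x y * f y := rfl

lemma grad_Uprop (n : ℕ) (ε t : ℝ) (φ : SchwartzMap (Rn n) ℂ) (x : Rn n) (j : Fin n) :
    grad (fun y => Uprop n ε t φ y) x j = mehlerC n ε t *
      ((Complex.I / ((ε * Real.sin t : ℝ) : ℂ)) *
        (((Real.cos t * x j : ℝ) : ℂ) *
          (∫ y, mehlerK (ε * Real.sin t) (Real.cos t) x y * φ y)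
          - ∫ y, mehlerK (ε * Real.sin t) (Real.cos t) x y * (((y j : ℝ) : ℂ) * φ y))) := by
  obtain ⟨L, hL, hj⟩ := mehler_hasFDerivAt (ε * Real.sin t) (Real.cos t) φ x
  unfold grad
  simp only [Uprop_eq]
  rw [(hL.const_mul (mehlerC n ε t)).fderiv, ContinuousLinearMap.smul_apply, hj j, smul_eq_mul]

lemma grad_Vprop (n : ℕ) (ε t : ℝ) (ht : t < π / 2) (φ : SchwartzMap (Rn n) ℂ) (x : Rn n)
    (j : Fin n) :
    grad (fun y => Vprop n ε t φ y) x j =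
      ((Real.cos t ^ (-(n : ℝ) / 2) : ℝ) : ℂ) *
      Complex.exp (-Complex.I * ((‖x‖ ^ 2 * Real.tan t / (2 * ε) : ℝ) : ℂ)) *
      (((Real.cos t)⁻¹ : ℝ) * grad φ ((Real.cos t)⁻¹ • x) j
        - Complex.I * ((x j * Real.tan t / ε : ℝ) : ℂ) * φ ((Real.cos t)⁻¹ • x)) := by
  unfold grad
  simp only [Vprop, if_pos ht]
  set C : ℂ := ((Real.cos t ^ (-(n : ℝ) / 2) : ℝ) : ℂ)
  set k : ℝ := (Real.cos t)⁻¹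
  have hs : HasFDerivAt (fun y : Rn n => k • y) (k • ContinuousLinearMap.id ℝ (Rn n)) x :=
    (hasFDerivAt_id x).const_smul k
  have h1 : HasFDerivAt (fun y : Rn n => φ (k • y)) _ x :=
    HasFDerivAt.comp x (φ.hasFDerivAt (k • x)) hs
  have h2 := (hasStrictFDerivAt_norm_sq x).hasFDerivAt.mul_const (Real.tan t / (2 * ε))
  have h3 := ((Complex.ofRealCLM.hasFDerivAt.comp x h2).const_mul (-Complex.I)).cexp
  have h4 := (h1.const_mul C).mul h3
  have h5 : HasFDerivAt (fun y : Rn n => C * φ (k • y) *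
      Complex.exp (-Complex.I * ((‖y‖ ^ 2 * Real.tan t / (2 * ε) : ℝ) : ℂ))) _ x :=
    h4.congr_of_eventuallyEq (Eventually.of_forall fun y => by simp [mul_div_assoc])
  rw [h5.fderiv]
  simp [EuclideanSpace.inner_single_right, mul_div_assoc]
  ring

/-- the Heisenberg-observable identities for t ∈ (0,π/2):
J^ε(t)U^ε(t)φ = U^ε(t)(−i∇φ), H^ε(t)U^ε(t)φ = U^ε(t)(xφ), and
J^ε(t)V^ε(t)φ = V^ε(t)(−i∇φ), pointwise and componentwise, where U^ε(t) is the Mehler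
propagator and V^ε(t)φ(x) = (cos t)^{−n/2} φ(x/cos t) e^{−i|x|²tan t/(2ε)}. -/
theorem stmt19 (n : ℕ) (hn : 1 ≤ n) (ε : ℝ) (hε : ε ∈ Set.Ioc (0 : ℝ) 1)
    (φ : SchwartzMap (Rn n) ℂ) (t : ℝ) (ht : t ∈ Set.Ioo 0 (π / 2)) :
    (∀ (x : Rn n) (j : Fin n),
      Jop ε t (fun y => Uprop n ε t ⇑φ y) x j
        = Uprop n ε t (fun y => -Complex.I * grad (⇑φ) y j) x)
    ∧ (∀ (x : Rn n) (j : Fin n),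
      Hop ε t (fun y => Uprop n ε t ⇑φ y) x j
        = Uprop n ε t (fun y => ((y j : ℝ) : ℂ) * φ y) x)
    ∧ (∀ (x : Rn n) (j : Fin n),
      Jop ε t (fun y => Vprop n ε t ⇑φ y) x j
        = Vprop n ε t (fun y => -Complex.I * grad (⇑φ) y j) x) := by
  obtain ⟨hε0, hε1⟩ := hε
  have hs : 0 < Real.sin t := Real.sin_pos_of_pos_of_lt_pi ht.1 (by linarith [ht.2, Real.pi_pos])
  have hc : 0 < Real.cos t := Real.cos_pos_of_mem_Ioo ⟨by linarith [ht.1, Real.pi_pos], ht.2⟩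
  have hεC : (ε : ℂ) ≠ 0 := by exact_mod_cast hε0.ne'
  have hsC : ((Real.sin t : ℝ) : ℂ) ≠ 0 := by exact_mod_cast hs.ne'
  have hcC : ((Real.cos t : ℝ) : ℂ) ≠ 0 := by exact_mod_cast hc.ne'
  have hsc : ((Real.sin t : ℝ) : ℂ) ^ 2 = 1 - ((Real.cos t : ℝ) : ℂ) ^ 2 := by
    have := Real.sin_sq t
    exact_mod_cast this
  refine ⟨fun x j => ?_, fun x j => ?_, fun x j => ?_⟩
  · unfold Jop
    rw [grad_Uprop]
    simp only [Uprop_eq]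
    have e : ∀ y, mehlerK (ε * Real.sin t) (Real.cos t) x y * (-Complex.I * grad φ y j)
        = -Complex.I * (mehlerK (ε * Real.sin t) (Real.cos t) x y *
          fderiv ℝ φ y (EuclideanSpace.single j 1)) := fun y => by
      unfold grad; ring
    simp only [e]
    rw [integral_const_mul, mehler_parts]
    generalize (∫ y, mehlerK (ε * Real.sin t) (Real.cos t) x y * φ y) = A
    generalize (∫ y, mehlerK (ε * Real.sin t) (Real.cos t) x y * (((y j : ℝ) : ℂ) * φ y)) = B
    generalize mehlerC n ε t = M
    simp only [Complex.ofReal_mul, Complex.ofReal_div]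
    generalize ((Real.sin t : ℝ) : ℂ) = s at *
    generalize ((Real.cos t : ℝ) : ℂ) = c at *
    field_simp
    simp only [Complex.I_sq]
    linear_combination (M * A * (x j : ℂ)) * hsc
  · unfold Hop
    rw [grad_Uprop]
    simp only [Uprop_eq]
    generalize (∫ y, mehlerK (ε * Real.sin t) (Real.cos t) x y * φ y) = A
    generalize (∫ y, mehlerK (ε * Real.sin t) (Real.cos t) x y * (((y j : ℝ) : ℂ) * φ y)) = B
    generalize mehlerC n ε t = M
    simp only [Complex.ofReal_mul]
    field_simp
    simp only [Complex.I_sq]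
    ring
  · unfold Jop
    rw [grad_Vprop n ε t ht.2]
    simp only [Vprop, if_pos ht.2]
    generalize Complex.exp (-Complex.I * ((‖x‖ ^ 2 * Real.tan t / (2 * ε) : ℝ) : ℂ)) = E
    generalize ((Real.cos t ^ (-(n : ℝ) / 2) : ℝ) : ℂ) = C
    generalize grad φ ((Real.cos t)⁻¹ • x) j = G
    generalize φ ((Real.cos t)⁻¹ • x) = P
    rw [Real.tan_eq_sin_div_cos]
    simp only [Complex.ofReal_mul, Complex.ofReal_div, Complex.ofReal_inv]
    field_simp
    linear_combination (C * E * P * (x j : ℂ) * ((Real.sin t : ℝ) : ℂ)) * Complex.I_sq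

end
end
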